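/- In sequential voting with 3 alternatives and at least two voters, under approval voting with either deterministic or uniform tie-breaking, or under plurality voting with uniform tie-breaking, no Pareto-dominated alternative can be part of the SPE winning set (the Pareto-dominated weak paradox cannot occur). -/

import Mathlib

open Classical

/-- `maxWrt worse s` picks the element of `s` that every other element of `s` is `worse` than. -/
noncomputable def maxWrt {O : Type} [Nonempty O] (worse : O → O → Prop) (s : Finset O) : O :=
  if h : ∃ o ∈ s, ∀ o' ∈ s, o' ≠ o → worse o' o then h.choose else Classical.arbitrary O

/-- Backward-induction (subgame perfect) outcome of a sequential game with `n` remaining movers,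
`worse k` the strict "is worse than" relation of the `k`-th mover on outcomes. -/
noncomputable def speOut {B O : Type} [Fintype B] [Nonempty O]
    (worse : ℕ → O → O → Prop) (outcome : List B → O) : ℕ → List B → O
  | 0, h => outcome h
  | n+1, h => maxWrt (worse h.length)
      (Finset.univ.image (fun b => speOut worse outcome n (h ++ [b])))

/-- number of ballots approving `x`. -/
def votes {m : ℕ} (h : List (Finset (Fin m))) (x : Fin m) : ℕ :=
  h.countP (fun b => decide (x ∈ b))

/-- set of alternatives with the maximal number of votes. -/
def winSet {m : ℕ} (h : List (Finset (Fin m))) : Finset (Fin m) :=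
  Finset.univ.filter (fun x => ∀ y, votes h y ≤ votes h x)

/-- deterministic tie-breaking: the member of the winning set with least tie-break rank. -/
noncomputable def detWinner {m : ℕ} [Nonempty (Fin m)] (tb : Fin m → ℕ)
    (h : List (Finset (Fin m))) : Fin m :=
  maxWrt (fun y x => tb x < tb y) (winSet h)

def topRank {m : ℕ} (r : Fin m → ℕ) (S : Finset (Fin m)) : WithTop ℕ := (S.image r).min

/-- remove the most preferred element. -/
def shed {m : ℕ} (r : Fin m → ℕ) (S : Finset (Fin m)) : Finset (Fin m) :=
  S.filter (fun a => (r a : WithTop ℕ) ≠ topRank r S)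

/-- the lifted strict preference on subsets: better top, or equal top and smaller,
or equal top and equal size and recursively better after removing the tops. -/
def liftBetter {m : ℕ} (r : Fin m → ℕ) : ℕ → Finset (Fin m) → Finset (Fin m) → Prop
  | 0, _, _ => False
  | fuel+1, S, S' =>
    topRank r S < topRank r S' ∨
    (topRank r S = topRank r S' ∧ S.card < S'.card) ∨
    (topRank r S = topRank r S' ∧ S.card = S'.card ∧
      liftBetter r fuel (shed r S) (shed r S'))

/-- `x` beats `y` in pairwise majority comparison. -/
def beats {n m : ℕ} (prof : Fin n → Fin m → ℕ) (x y : Fin m) : Prop :=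
  (Finset.univ.filter (fun i => prof i x < prof i y)).card >
  (Finset.univ.filter (fun i => prof i y < prof i x)).card

section BackwardInduction

theorem exists_greatest {O : Type} {r : O → O → Prop} [IsStrictTotalOrder O r]
    (s : Finset O) (hs : s.Nonempty) : ∃ o ∈ s, ∀ o' ∈ s, o' ≠ o → r o' o := by
  induction hs using Finset.Nonempty.cons_induction with
  | singleton a => exact ⟨a, by simp, by simp⟩
  | cons a s ha hs ih =>
    obtain ⟨o, ho, hmax⟩ := ih
    rcases trichotomous_of r a o with h | h | h
    · refine ⟨o, by simp [ho], fun o' ho' hne => ?_⟩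
      rcases Finset.mem_cons.1 ho' with rfl | h'
      · exact h
      · exact hmax o' h' hne
    · exact absurd (h ▸ ho) ha
    · refine ⟨a, by simp, fun o' ho' hne => ?_⟩
      rcases Finset.mem_cons.1 ho' with rfl | h'
      · exact absurd rfl hne
      · by_cases heq : o' = o
        · exact heq ▸ h
        · exact trans_of r (hmax o' h' heq) h

theorem maxWrt_spec {O : Type} [Nonempty O] {r : O → O → Prop} [IsStrictTotalOrder O r]
    {s : Finset O} (hs : s.Nonempty) :
    maxWrt r s ∈ s ∧ ∀ o' ∈ s, o' ≠ maxWrt r s → r o' (maxWrt r s) := by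
  have h := exists_greatest (r := r) s hs
  rw [maxWrt, dif_pos h]
  exact h.choose_spec

variable {B O : Type} [Fintype B] [Nonempty O]

theorem speOut_succ_spec [Nonempty B] (worse : ℕ → O → O → Prop) (outcome : List B → O)
    (k : ℕ) (h : List B) [IsStrictTotalOrder O (worse h.length)] :
    (∃ b, speOut worse outcome k (h ++ [b]) = speOut worse outcome (k + 1) h) ∧
    ∀ b, speOut worse outcome k (h ++ [b]) ≠ speOut worse outcome (k + 1) h →
      worse h.length (speOut worse outcome k (h ++ [b])) (speOut worse outcome (k + 1) h) := by
  have hs := maxWrt_spec (r := worse h.length)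
    (s := Finset.univ.image fun b => speOut worse outcome k (h ++ [b]))
    (Finset.univ_nonempty.image _)
  refine ⟨?_, fun b hb => hs.2 _ (Finset.mem_image_of_mem _ (Finset.mem_univ b)) hb⟩
  obtain ⟨b, -, hb⟩ := Finset.mem_image.1 hs.1
  exact ⟨b, hb⟩

/-- A property of final outcomes holds for the backward-induction outcome as soon as an
invariant guaranteeing it at the end can be kept, at each node, either by every move or by
some move of a mover who prefers outcomes with the property. -/
theorem speOut_of_invariant [Nonempty B] {worse : ℕ → O → O → Prop} {outcome : List B → O}
    {n : ℕ} (hw : ∀ j < n, IsStrictTotalOrder O (worse j)) {Good : O → Prop}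
    (Inv : ℕ → List B → Prop) (base : ∀ h, Inv 0 h → Good (outcome h))
    (step : ∀ k h, h.length + (k + 1) = n → Inv (k + 1) h →
      (∀ b, Inv k (h ++ [b])) ∨
      ((∃ b, Inv k (h ++ [b])) ∧ ∀ o o', Good o → ¬ Good o' →
        o' = speOut worse outcome (k + 1) h → worse h.length o' o)) :
    ∀ k h, h.length + k = n → Inv k h → Good (speOut worse outcome k h) := by
  intro k
  induction k with
  | zero => exact fun h _ hI => base h hI
  | succ k ih =>
    intro h hlen hI
    have := hw h.length (by omega)
    obtain ⟨⟨b₀, hb₀⟩, hopt⟩ := speOut_succ_spec worse outcome k h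
    have next : ∀ b, Inv k (h ++ [b]) → Good (speOut worse outcome k (h ++ [b])) :=
      fun b hb => ih _ (by simp; omega) hb
    rcases step k h hlen hI with hall | ⟨⟨b, hb⟩, hpref⟩
    · exact hb₀ ▸ next b₀ (hall b₀)
    · by_contra hbad
      have hgood := next b hb
      have hne : speOut worse outcome k (h ++ [b]) ≠ speOut worse outcome (k + 1) h :=
        fun heq => hbad (heq ▸ hgood)
      exact asymm_of (worse h.length) (hopt b hne) (hpref _ _ hgood hbad rfl)

end BackwardInduction

section Counting

/-- Number of indices among `j, …, j + k - 1` satisfying `P`. -/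
noncomputable def countFrom (P : ℕ → Prop) : ℕ → ℕ → ℕ
  | 0, _ => 0
  | k + 1, j => (if P j then 1 else 0) + countFrom P k (j + 1)

theorem countFrom_add_not (P : ℕ → Prop) (k j : ℕ) :
    countFrom P k j + countFrom (fun i => ¬ P i) k j = k := by
  induction k generalizing j with
  | zero => rfl
  | succ k ih =>
    have := ih (j + 1)
    by_cases h : P j <;> simp only [countFrom, h, not_true, not_false_iff, if_true, if_false] <;>
      omega

theorem countFrom_le {P Q : ℕ → Prop} (k j : ℕ) (hPQ : ∀ i, j ≤ i → i < j + k → P i → Q i) :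
    countFrom P k j ≤ countFrom Q k j := by
  induction k generalizing j with
  | zero => exact le_rfl
  | succ k ih =>
    have := ih (j + 1) fun i h₁ h₂ => hPQ i (by omega) (by omega)
    have h := hPQ j le_rfl (by omega)
    by_cases hP : P j
    · simp only [countFrom, hP, h hP, if_true]; omega
    · simp only [countFrom, hP, if_false]; omega

theorem imp_of_countFrom_le {P Q : ℕ → Prop} (k j : ℕ)
    (hPQ : ∀ i, j ≤ i → i < j + k → P i → Q i) (hle : countFrom Q k j ≤ countFrom P k j) :
    ∀ i, j ≤ i → i < j + k → Q i → P i := by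
  induction k generalizing j with
  | zero => intro i; omega
  | succ k ih =>
    have hPQ' : ∀ i, j + 1 ≤ i → i < j + 1 + k → P i → Q i :=
      fun i h₁ h₂ => hPQ i (by omega) (by omega)
    have hmono := countFrom_le k (j + 1) hPQ'
    have h := hPQ j le_rfl (by omega)
    simp only [countFrom] at hle
    intro i h₁ h₂ hQ
    rcases Nat.eq_or_lt_of_le h₁ with rfl | h₁
    · by_contra hP
      simp only [hP, hQ, if_true, if_false] at hle
      omega
    · refine ih (j + 1) hPQ' ?_ i h₁ (by omega) hQ
      by_cases hP : P j
      · simp only [hP, h hP, if_true] at hle; omega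
      · simp only [hP, if_false] at hle; omega

end Counting

section Votes

variable {m : ℕ}

theorem votes_append_singleton (h : List (Finset (Fin m))) (b : Finset (Fin m)) (w : Fin m) :
    votes (h ++ [b]) w = votes h w + if w ∈ b then 1 else 0 := by
  simp [votes, List.countP_append, List.countP_singleton]

theorem votes_map_append {B : Type*} (val : B → Finset (Fin m)) (h : List B) (b : B) (w : Fin m) :
    votes ((h ++ [b]).map val) w = votes (h.map val) w + if w ∈ val b then 1 else 0 := by
  rw [List.map_append, List.map_singleton, votes_append_singleton]

theorem mem_winSet {h : List (Finset (Fin m))} {w : Fin m} :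
    w ∈ winSet h ↔ ∀ v, votes h v ≤ votes h w := by
  simp [winSet]

theorem winSet_nonempty [Nonempty (Fin m)] (h : List (Finset (Fin m))) : (winSet h).Nonempty := by
  obtain ⟨w, hw⟩ := Finite.exists_max (votes h)
  exact ⟨w, mem_winSet.2 hw⟩

theorem isStrictTotalOrder_rank_gt {α : Type} {r : α → ℕ} (hr : Function.Injective r) :
    IsStrictTotalOrder α (fun u v => r v < r u) where
  irrefl _ := lt_irrefl _
  trans _ _ _ h₁ h₂ := h₂.trans h₁
  trichotomous _ _ h₁ h₂ := hr (le_antisymm (not_lt.1 h₁) (not_lt.1 h₂))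

theorem detWinner_spec [Nonempty (Fin m)] {tb : Fin m → ℕ} (htb : Function.Injective tb)
    (h : List (Finset (Fin m))) :
    (∀ v, votes h v ≤ votes h (detWinner tb h)) ∧
    ∀ v, votes h v = votes h (detWinner tb h) → tb (detWinner tb h) ≤ tb v := by
  have := isStrictTotalOrder_rank_gt htb
  have hs := maxWrt_spec (r := fun y x => tb x < tb y) (winSet_nonempty h)
  have hmem := mem_winSet.1 hs.1
  refine ⟨hmem, fun v hv => ?_⟩
  by_cases heq : v = detWinner tb h
  · rw [heq]
  · exact (hs.2 v (mem_winSet.2 fun u => (hmem u).trans hv.ge) heq).le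

end Votes

section Lift

variable {m : ℕ} {r : Fin m → ℕ}

theorem topRank_le {S : Finset (Fin m)} {a : Fin m} (ha : a ∈ S) : topRank r S ≤ r a :=
  Finset.min_le (Finset.mem_image_of_mem r ha)

theorem exists_topRank_eq {S : Finset (Fin m)} (hS : S.Nonempty) :
    ∃ a ∈ S, topRank r S = r a := by
  obtain ⟨c, hc⟩ := Finset.min_of_nonempty (hS.image r)
  obtain ⟨a, ha, rfl⟩ := Finset.mem_image.1 (Finset.mem_of_min hc)
  exact ⟨a, ha, hc⟩

theorem shed_eq_erase (hr : Function.Injective r) {S : Finset (Fin m)} {a : Fin m}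
    (htop : topRank r S = r a) : shed r S = S.erase a := by
  ext b
  simp only [shed, htop, Finset.mem_filter, Finset.mem_erase, ne_eq,
    hr.eq_iff, Nat.cast_inj]
  tauto

theorem liftBetter_irrefl (k : ℕ) (S : Finset (Fin m)) : ¬ liftBetter r k S S := by
  induction k generalizing S with
  | zero => exact id
  | succ k ih => simp [liftBetter, ih]

theorem liftBetter_trans (k : ℕ) {S T U : Finset (Fin m)} (h₁ : liftBetter r k S T)
    (h₂ : liftBetter r k T U) : liftBetter r k S U := by
  induction k generalizing S T U with
  | zero => exact h₁
  | succ k ih =>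
    simp only [liftBetter] at h₁ h₂ ⊢
    rcases h₁ with h₁ | ⟨e₁, h₁⟩ | ⟨e₁, c₁, h₁⟩ <;> rcases h₂ with h₂ | ⟨e₂, h₂⟩ | ⟨e₂, c₂, h₂⟩
    · exact Or.inl (h₁.trans h₂)
    · exact Or.inl (e₂ ▸ h₁)
    · exact Or.inl (e₂ ▸ h₁)
    · exact Or.inl (e₁ ▸ h₂)
    · exact Or.inr (Or.inl ⟨e₁.trans e₂, h₁.trans h₂⟩)
    · exact Or.inr (Or.inl ⟨e₁.trans e₂, by omega⟩)
    · exact Or.inl (e₁ ▸ h₂)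
    · exact Or.inr (Or.inl ⟨e₁.trans e₂, by omega⟩)
    · exact Or.inr (Or.inr ⟨e₁.trans e₂, c₁.trans c₂, ih h₁ h₂⟩)

theorem liftBetter_trichotomous (hr : Function.Injective r) (k : ℕ) {S T : Finset (Fin m)}
    (hk : S.card ≤ k) (h₁ : ¬ liftBetter r k S T) (h₂ : ¬ liftBetter r k T S)
    (hk' : T.card ≤ k) : S = T := by
  induction k generalizing S T with
  | zero =>
    rw [Finset.card_eq_zero.1 (Nat.le_zero.1 hk), Finset.card_eq_zero.1 (Nat.le_zero.1 hk')]
  | succ k ih =>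
    simp only [liftBetter, not_or, not_and] at h₁ h₂
    have htop : topRank r S = topRank r T := le_antisymm (not_lt.1 h₂.1) (not_lt.1 h₁.1)
    have hcard : S.card = T.card :=
      le_antisymm (not_lt.1 (h₂.2.1 htop.symm)) (not_lt.1 (h₁.2.1 htop))
    rcases S.eq_empty_or_nonempty with rfl | hS
    · exact (Finset.card_eq_zero.1 (hcard.symm.trans Finset.card_empty)).symm
    have hT : T.Nonempty := by rwa [← Finset.card_pos, ← hcard, Finset.card_pos]
    obtain ⟨a, ha, hSa⟩ := exists_topRank_eq (r := r) hS
    obtain ⟨b, hb, hTb⟩ := exists_topRank_eq (r := r) hT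
    obtain rfl : a = b := hr (by exact_mod_cast (hSa.symm.trans htop).trans hTb)
    have h₁' := h₁.2.2 htop hcard
    have h₂' := h₂.2.2 htop.symm hcard.symm
    rw [shed_eq_erase hr hSa, shed_eq_erase hr hTb] at h₁' h₂'
    have := ih (by rw [Finset.card_erase_of_mem ha]; omega) h₁' h₂'
      (by rw [Finset.card_erase_of_mem hb]; omega)
    rw [← Finset.insert_erase ha, this, Finset.insert_erase hb]

theorem isStrictTotalOrder_liftBetter (hr : Function.Injective r) {k : ℕ} (hk : m ≤ k) :
    IsStrictTotalOrder (Finset (Fin m)) (fun S T => liftBetter r k T S) where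
  irrefl := liftBetter_irrefl k
  trans _ _ _ h₁ h₂ := liftBetter_trans k h₂ h₁
  trichotomous S T h₁ h₂ := by
    have hcard : ∀ U : Finset (Fin m), U.card ≤ k :=
      fun U => (U.card_le_univ.trans_eq (Fintype.card_fin m)).trans hk
    exact liftBetter_trichotomous hr k (hcard S) h₂ h₁ (hcard T)

variable {t : Fin m}

theorem topRank_eq_of_mem (ht : ∀ w, w ≠ t → r t < r w) {S : Finset (Fin m)} (hS : t ∈ S) :
    topRank r S = r t := by
  obtain ⟨a, -, h⟩ := exists_topRank_eq (r := r) ⟨t, hS⟩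
  refine le_antisymm (topRank_le hS) (h ▸ ?_)
  by_cases hat : a = t
  · rw [hat]
  · exact_mod_cast (ht a hat).le

theorem topRank_lt_of_notMem (ht : ∀ w, w ≠ t → r t < r w) {S : Finset (Fin m)} (hS : t ∉ S) :
    (r t : WithTop ℕ) < topRank r S := by
  rcases S.eq_empty_or_nonempty with rfl | hne
  · simp [topRank]
  · obtain ⟨a, ha, h⟩ := exists_topRank_eq (r := r) hne
    rw [h]
    exact_mod_cast ht a fun hat => hS (hat ▸ ha)

theorem liftBetter_of_mem_of_notMem (ht : ∀ w, w ≠ t → r t < r w) (k : ℕ)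
    {S T : Finset (Fin m)} (hS : t ∈ S) (hT : t ∉ T) : liftBetter r (k + 1) S T :=
  Or.inl (topRank_eq_of_mem ht hS ▸ topRank_lt_of_notMem ht hT)

theorem liftBetter_of_card_lt (ht : ∀ w, w ≠ t → r t < r w) (k : ℕ)
    {S T : Finset (Fin m)} (hS : t ∈ S) (hT : t ∈ T) (hcard : S.card < T.card) :
    liftBetter r (k + 1) S T :=
  Or.inr (Or.inl ⟨(topRank_eq_of_mem ht hS).trans (topRank_eq_of_mem ht hT).symm, hcard⟩)

theorem liftBetter_singleton (ht : ∀ w, w ≠ t → r t < r w) (k : ℕ)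
    {T : Finset (Fin m)} (hT : T ≠ {t}) : liftBetter r (k + 1) {t} T := by
  by_cases h : t ∈ T
  · refine liftBetter_of_card_lt ht k (Finset.mem_singleton_self t) h ?_
    exact Finset.card_lt_card ((Finset.singleton_subset_iff.2 h).ssubset_of_ne hT.symm)
  · exact liftBetter_of_mem_of_notMem ht k (Finset.mem_singleton_self t) h

end Lift

section Uniform

variable {m n : ℕ} {B : Type} [Fintype B] [Nonempty B] {val : B → Finset (Fin m)}
  {prof : ℕ → Fin m → ℕ} {P : ℕ → Prop} {t : Fin m}

theorem speOut_uniform_eq_singleton_of_majority (hinj : ∀ i < n, Function.Injective (prof i))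
    (hP : ∀ i < n, P i → ∀ w, w ≠ t → prof i t < prof i w) {b₀ : B} (hb₀ : val b₀ = {t})
    {k : ℕ} (hk : m ≤ k + 1) :
    ∀ q (h : List B), h.length + q = n →
      (∀ w, w ≠ t → votes (h.map val) w + countFrom (fun i => ¬ P i) q h.length <
        votes (h.map val) t + countFrom P q h.length) →
      speOut (fun i (S S' : Finset (Fin m)) => liftBetter (prof i) (k + 1) S' S)
        (fun h : List B => winSet (h.map val)) q h = {t} := by
  refine speOut_of_invariant (outcome := fun h : List B => winSet (h.map val))
    (Good := fun o => o = {t}) (fun j hj => isStrictTotalOrder_liftBetter (hinj j hj) hk)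
    (fun q (h : List B) => ∀ w, w ≠ t →
      votes (h.map val) w + countFrom (fun i => ¬ P i) q h.length <
        votes (h.map val) t + countFrom P q h.length) (fun h hI => ?_) fun q h hlen hI => ?_
  · ext w
    simp only [mem_winSet, Finset.mem_singleton]
    simp only [countFrom, add_zero] at hI
    refine ⟨fun hw => ?_, ?_⟩
    · by_contra hne
      exact absurd (hI w hne) (hw t).not_gt
    · rintro rfl v
      by_cases hv : v = w
      · rw [hv]
      · exact (hI v hv).le
  · by_cases hPj : P h.length
    · refine Or.inr ⟨⟨b₀, fun w hw => ?_⟩, ?_⟩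
      · have := hI w hw
        simp only [countFrom, hPj, votes_map_append, hb₀, hw, List.length_append,
          List.length_singleton, Finset.mem_singleton, if_true, if_false, not_true] at this ⊢
        omega
      · rintro o o' rfl hne -
        exact liftBetter_singleton (hP _ (by omega) hPj) k hne
    · refine Or.inl fun b w hw => ?_
      have := hI w hw
      simp only [countFrom, hPj, votes_map_append, List.length_append, List.length_singleton,
        if_true, if_false, not_false_iff] at this ⊢
      split_ifs <;> omega

theorem mem_speOut_uniform_of_weak_majority (hinj : ∀ i < n, Function.Injective (prof i))
    (hP : ∀ i < n, P i → ∀ w, w ≠ t → prof i t < prof i w) {b₀ : B} (hb₀ : val b₀ = {t})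
    {k : ℕ} (hk : m ≤ k + 1) :
    ∀ q (h : List B), h.length + q = n →
      (∀ w, w ≠ t → votes (h.map val) w + countFrom (fun i => ¬ P i) q h.length ≤
        votes (h.map val) t + countFrom P q h.length) →
      t ∈ speOut (fun i (S S' : Finset (Fin m)) => liftBetter (prof i) (k + 1) S' S)
        (fun h : List B => winSet (h.map val)) q h := by
  refine speOut_of_invariant (outcome := fun h : List B => winSet (h.map val))
    (Good := fun o => t ∈ o) (fun j hj => isStrictTotalOrder_liftBetter (hinj j hj) hk)
    (fun q (h : List B) => ∀ w, w ≠ t →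
      votes (h.map val) w + countFrom (fun i => ¬ P i) q h.length ≤
        votes (h.map val) t + countFrom P q h.length) (fun h hI => ?_) fun q h hlen hI => ?_
  · simp only [countFrom, add_zero] at hI
    refine mem_winSet.2 fun v => ?_
    by_cases hv : v = t
    · rw [hv]
    · exact hI v hv
  · by_cases hPj : P h.length
    · refine Or.inr ⟨⟨b₀, fun w hw => ?_⟩, fun o o' ho ho' _ =>
        liftBetter_of_mem_of_notMem (hP _ (by omega) hPj) k ho ho'⟩
      have := hI w hw
      simp only [countFrom, hPj, votes_map_append, hb₀, hw, List.length_append,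
        List.length_singleton, Finset.mem_singleton, if_true, if_false, not_true] at this ⊢
      omega
    · refine Or.inl fun b w hw => ?_
      have := hI w hw
      simp only [countFrom, hPj, votes_map_append, List.length_append, List.length_singleton,
        if_true, if_false, not_false_iff] at this ⊢
      split_ifs <;> omega

end Uniform

section ThreeAlternatives

variable {n : ℕ} {prof : ℕ → Fin 3 → ℕ} {x y z : Fin 3}

theorem exists_third {x y : Fin 3} (hxy : x ≠ y) :
    ∃ z, z ≠ x ∧ z ≠ y ∧ ∀ w, w = x ∨ w = y ∨ w = z := by
  revert x y
  decide

/-- When the alternatives `x` and `z` split the voters into two equally large halves ranking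
them first, both of them win. -/
theorem speOut_uniform_eq_pair_of_balanced {B : Type} [Fintype B] [Nonempty B]
    {val : B → Finset (Fin 3)} (hinj : ∀ i < n, Function.Injective (prof i))
    (hxy : x ≠ y) (hzx : z ≠ x) (hzy : z ≠ y) (hcases : ∀ w, w = x ∨ w = y ∨ w = z)
    {P : ℕ → Prop} (hPx : ∀ i < n, P i → ∀ w, w ≠ x → prof i x < prof i w)
    (hPz : ∀ i < n, ¬ P i → ∀ w, w ≠ z → prof i z < prof i w)
    {bx bz : B} (hbx : val bx = {x}) (hbz : val bz = {z}) :
    ∀ q (h : List B), h.length + q = n →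
      (votes (h.map val) x + countFrom P q h.length =
          votes (h.map val) z + countFrom (fun i => ¬ P i) q h.length ∧
        votes (h.map val) y + countFrom (fun i => ¬ P i) q h.length ≤
          votes (h.map val) x + countFrom P q h.length ∧
        votes (h.map val) y + countFrom P q h.length ≤
          votes (h.map val) z + countFrom (fun i => ¬ P i) q h.length ∧
        (votes (h.map val) y < votes (h.map val) x ∨
          votes (h.map val) y < votes (h.map val) z ∨ 0 < q)) →
      speOut (fun i (S S' : Finset (Fin 3)) => liftBetter (prof i) 3 S' S)
        (fun h : List B => winSet (h.map val)) q h = {x, z} := by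
  refine speOut_of_invariant (outcome := fun h : List B => winSet (h.map val))
    (Good := fun o => o = {x, z}) (fun j hj => isStrictTotalOrder_liftBetter (hinj j hj) le_rfl)
    (fun q (h : List B) => votes (h.map val) x + countFrom P q h.length =
          votes (h.map val) z + countFrom (fun i => ¬ P i) q h.length ∧
        votes (h.map val) y + countFrom (fun i => ¬ P i) q h.length ≤
          votes (h.map val) x + countFrom P q h.length ∧
        votes (h.map val) y + countFrom P q h.length ≤
          votes (h.map val) z + countFrom (fun i => ¬ P i) q h.length ∧
        (votes (h.map val) y < votes (h.map val) x ∨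
          votes (h.map val) y < votes (h.map val) z ∨ 0 < q)) (fun h hI => ?_)
    fun q h hlen hI => ?_
  · simp only [countFrom, add_zero, lt_irrefl, or_false] at hI
    obtain ⟨h₁, -, -, h₄⟩ := hI
    ext w
    simp only [mem_winSet, Finset.mem_insert, Finset.mem_singleton]
    rcases hcases w with rfl | rfl | rfl
    · simp only [true_or, iff_true]
      intro v
      rcases hcases v with rfl | rfl | rfl <;> omega
    · simp only [hxy.symm, hzy.symm, or_false, iff_false, not_forall]
      exact ⟨x, by omega⟩
    · simp only [or_true, iff_true]
      intro v
      rcases hcases v with rfl | rfl | rfl <;> omega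
  · have hx_mem := mem_speOut_uniform_of_weak_majority hinj hPx hbx (k := 2) le_rfl (q + 1) h hlen
      fun w hw => by
        rcases hcases w with rfl | rfl | rfl
        · exact absurd rfl hw
        · exact hI.2.1
        · exact hI.1.ge
    have hz_mem := mem_speOut_uniform_of_weak_majority hinj hPz hbz (k := 2) le_rfl (q + 1) h hlen
      fun w hw => by
        simp only [not_not]
        rcases hcases w with rfl | rfl | rfl
        · exact hI.1.le
        · exact hI.2.2.1
        · exact absurd rfl hw
    have hpref : ∀ t, t ∈ ({x, z} : Finset (Fin 3)) →
        (∀ w, w ≠ t → prof h.length t < prof h.length w) → ∀ o o' : Finset (Fin 3),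
        o = {x, z} → o' ≠ {x, z} →
        o' = speOut (fun i (S S' : Finset (Fin 3)) => liftBetter (prof i) 3 S' S)
          (fun h : List B => winSet (h.map val)) (q + 1) h →
        liftBetter (prof h.length) 3 o o' := by
      rintro t ht htop o o' rfl hne heq
      have hsub : ({x, z} : Finset (Fin 3)) ⊆ o' := by
        intro w hw
        rw [heq]
        rcases Finset.mem_insert.1 hw with rfl | hw
        · exact hx_mem
        · exact Finset.mem_singleton.1 hw ▸ hz_mem
      exact liftBetter_of_card_lt htop 2 ht (hsub ht)
        (Finset.card_lt_card (hsub.ssubset_of_ne hne.symm))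
    by_cases hP : P h.length
    · refine Or.inr ⟨⟨bx, ?_⟩, hpref x (by simp) (hPx _ (by omega) hP)⟩
      simp only [countFrom, hP, votes_map_append, hbx, hzx, hxy.symm, List.length_append,
        List.length_singleton, Finset.mem_singleton, if_true, if_false, not_true] at hI ⊢
      omega
    · refine Or.inr ⟨⟨bz, ?_⟩, hpref z (by simp) (hPz _ (by omega) hP)⟩
      simp only [countFrom, hP, votes_map_append, hbz, hzx.symm, hzy.symm, List.length_append,
        List.length_singleton, Finset.mem_singleton, if_true, if_false, not_false_iff] at hI ⊢
      omega

theorem notMem_speOut_uniform {B : Type} [Fintype B] {val : B → Finset (Fin 3)}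
    (hn : 0 < n) (hinj : ∀ i < n, Function.Injective (prof i))
    (hdom : ∀ i < n, prof i x < prof i y) (hval : ∀ w, ∃ b, val b = {w}) :
    y ∉ speOut (fun i (S S' : Finset (Fin 3)) => liftBetter (prof i) 3 S' S)
        (fun h : List B => winSet (h.map val)) n [] := by
  have : Nonempty B := ⟨(hval x).choose⟩
  have hxy : x ≠ y := fun h => lt_irrefl _ (h ▸ hdom 0 hn)
  obtain ⟨z, hzx, hzy, hcases⟩ := exists_third hxy
  obtain ⟨bx, hbx⟩ := hval x
  obtain ⟨bz, hbz⟩ := hval z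
  have hPx : ∀ i < n, prof i x < prof i z → ∀ w, w ≠ x → prof i x < prof i w := by
    intro i hi hP w hw
    rcases hcases w with rfl | rfl | rfl
    exacts [absurd rfl hw, hdom i hi, hP]
  have hPz : ∀ i < n, ¬ prof i x < prof i z → ∀ w, w ≠ z → prof i z < prof i w := by
    intro i hi hP w hw
    have hlt : prof i z < prof i x :=
      lt_of_le_of_ne (not_lt.1 hP) fun h => hzx (hinj i hi h)
    rcases hcases w with rfl | rfl | rfl
    exacts [hlt, hlt.trans (hdom i hi), absurd rfl hw]
  rcases lt_trichotomy (countFrom (fun i => ¬ prof i x < prof i z) n 0)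
    (countFrom (fun i => prof i x < prof i z) n 0) with h | h | h
  · rw [speOut_uniform_eq_singleton_of_majority hinj hPx hbx (k := 2) le_rfl n [] (by simp)
      fun w _ => by simpa [votes] using h]
    simpa using hxy.symm
  · rw [speOut_uniform_eq_pair_of_balanced hinj hxy hzx hzy hcases hPx hPz hbx hbz n [] (by simp)
      ⟨by simpa [votes] using h.symm, by simpa [votes] using h.le, by simpa [votes] using h.ge,
        Or.inr (Or.inr hn)⟩]
    simpa using ⟨hxy.symm, hzy.symm⟩
  · rw [speOut_uniform_eq_singleton_of_majority hinj hPz hbz (k := 2) le_rfl n [] (by simp)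
      fun w _ => by simpa [votes] using h]
    simpa using hzy.symm

theorem speOut_det_ne {tb : Fin 3 → ℕ} (htb : Function.Injective tb)
    (hn : 2 ≤ n) (hinj : ∀ i < n, Function.Injective (prof i))
    (hdom : ∀ i < n, prof i x < prof i y) :
    speOut (fun i (u v : Fin 3) => prof i v < prof i u)
        (fun h : List (Finset (Fin 3)) => detWinner tb h) n [] ≠ y := by
  have hxy : x ≠ y := fun h => lt_irrefl _ (h ▸ hdom 0 (by omega))
  obtain ⟨z, hzx, hzy, hcases⟩ := exists_third hxy
  have hw : ∀ j < n, IsStrictTotalOrder (Fin 3) (fun u v => prof j v < prof j u) :=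
    fun j hj => isStrictTotalOrder_rank_gt (hinj j hj)
  have hne : ∀ i < n, prof i y ≠ prof i z ∧ prof i x ≠ prof i z := fun i hi =>
    ⟨fun h => hzy (hinj i hi h).symm, fun h => hzx (hinj i hi h).symm⟩
  -- `z` is sure to beat `y`
  have hz_beats := speOut_of_invariant (outcome := fun h => detWinner tb h) hw
    (Good := fun o => o ≠ y)
    (fun q (h : List (Finset (Fin 3))) =>
      votes h y + countFrom (fun i => prof i y < prof i z) q h.length +
          (if tb y < tb z then 1 else 0) ≤
        votes h z + countFrom (fun i => ¬ prof i y < prof i z) q h.length)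
    (fun h hI hy => by
      obtain ⟨h₁, h₂⟩ := detWinner_spec htb h
      rw [hy] at h₁ h₂
      have h₁ := h₁ z
      have h₂ := h₂ z
      have h₃ : tb y ≠ tb z := fun h => hzy (htb h).symm
      simp only [countFrom, add_zero] at hI
      split_ifs at hI <;> omega)
    (fun q h hlen hI => by
      by_cases hP : prof h.length y < prof h.length z
      · refine Or.inl fun b => ?_
        simp only [countFrom, hP, votes_append_singleton, List.length_append,
          List.length_singleton, if_true, if_false, not_true] at hI ⊢
        split_ifs at hI ⊢ <;> omega
      · refine Or.inr ⟨⟨{z}, ?_⟩, fun o o' ho ho' _ => ?_⟩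
        · simp only [countFrom, hP, votes_append_singleton, List.length_append, hzy.symm,
            Finset.mem_singleton, List.length_singleton, if_true, if_false, not_false_iff] at hI ⊢
          split_ifs at hI ⊢ <;> omega
        · obtain rfl := not_not.1 ho'
          have := hdom h.length (by omega)
          have := hne h.length (by omega)
          rcases hcases o with rfl | rfl | rfl <;> omega)
    n [] (by simp)
  -- a majority ranks `x` first
  have hx_majority := speOut_of_invariant (outcome := fun h => detWinner tb h) hw
    (Good := fun o => o = x)
    (fun q (h : List (Finset (Fin 3))) => ∀ w, w ≠ x →
      votes h w + countFrom (fun i => ¬ prof i x < prof i z) q h.length <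
        votes h x + countFrom (fun i => prof i x < prof i z) q h.length)
    (fun h hI => by
      by_contra hw
      have h₁ := (detWinner_spec htb h).1 x
      have := hI _ hw
      simp only [countFrom] at this
      omega)
    (fun q h hlen hI => by
      by_cases hP : prof h.length x < prof h.length z
      · refine Or.inr ⟨⟨{x}, fun w hw => ?_⟩, fun o o' ho ho' _ => ?_⟩
        · have := hI w hw
          simp only [countFrom, hP, votes_append_singleton, List.length_append, hw,
            Finset.mem_singleton, List.length_singleton, if_true, if_false, not_true] at this ⊢
          omega
        · subst ho
          have := hdom h.length (by omega)
          rcases hcases o' with rfl | rfl | rfl <;> omega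
      · refine Or.inl fun b w hw => ?_
        have := hI w hw
        simp only [countFrom, hP, votes_append_singleton, List.length_append,
          List.length_singleton, if_true, if_false, not_false_iff] at this ⊢
        split_ifs <;> omega)
    n [] (by simp)
  have hA := countFrom_add_not (fun i => prof i y < prof i z) n 0
  have hX := countFrom_add_not (fun i => prof i x < prof i z) n 0
  have himp : ∀ i, 0 ≤ i → i < 0 + n → prof i y < prof i z → prof i x < prof i z :=
    fun i _ hi h => (hdom i (by omega)).trans h
  have hle := countFrom_le n 0 himp
  intro hy
  have h₁ := mt hz_beats (not_not.2 hy)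
  have h₂ := mt hx_majority fun h => hxy (h.symm.trans hy)
  simp only [votes, List.countP_nil, List.length_nil, zero_add, not_forall] at h₁ h₂
  obtain ⟨-, -, h₂⟩ := h₂
  have hall := imp_of_countFrom_le n 0 himp (by split_ifs at h₁ <;> omega)
  have hbal : countFrom (fun i => ¬ prof i y < prof i z) n 0 =
      countFrom (fun i => prof i y < prof i z) n 0 := by split_ifs at h₁ <;> omega
  have htb_yz : tb y < tb z := by
    by_contra h
    rw [if_neg h] at h₁
    omega
  -- `y` is sure to beat `z`
  have hz_loses := speOut_of_invariant (outcome := fun h => detWinner tb h) hw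
    (Good := fun o => o ≠ z)
    (fun q (h : List (Finset (Fin 3))) =>
      votes h z + countFrom (fun i => ¬ prof i y < prof i z) q h.length ≤
        votes h y + countFrom (fun i => prof i y < prof i z) q h.length)
    (fun h hI hz => by
      obtain ⟨h₁, h₂⟩ := detWinner_spec htb h
      rw [hz] at h₁ h₂
      have h₁ := h₁ y
      have h₂ := h₂ y
      simp only [countFrom, add_zero] at hI
      omega)
    (fun q h hlen hI => by
      by_cases hP : prof h.length y < prof h.length z
      · refine Or.inr ⟨⟨{y}, ?_⟩, fun o o' ho ho' _ => ?_⟩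
        · simp only [countFrom, hP, votes_append_singleton, List.length_append, hzy,
            Finset.mem_singleton, List.length_singleton, if_true, if_false, not_true] at hI ⊢
          omega
        · obtain rfl := not_not.1 ho'
          have := hdom h.length (by omega)
          rcases hcases o with rfl | rfl | rfl <;> omega
      · refine Or.inl fun b => ?_
        simp only [countFrom, hP, votes_append_singleton, List.length_append,
          List.length_singleton, if_true, if_false, not_false_iff] at hI ⊢
        split_ifs <;> omega)
  have hx_wins := speOut_of_invariant (outcome := fun h => detWinner tb h) hw
    (Good := fun o => o = x)
    (fun q (h : List (Finset (Fin 3))) =>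
      votes h z + countFrom (fun i => ¬ prof i y < prof i z) q h.length ≤
        votes h y + countFrom (fun i => prof i y < prof i z) q h.length ∧
      votes h y < votes h x + countFrom (fun i => ¬ prof i y < prof i z) q h.length ∧
      votes h y ≤ votes h x)
    (fun h hI => by
      have h₁ := (detWinner_spec htb h).1 x
      simp only [countFrom, add_zero] at hI
      rcases hcases (detWinner tb h) with h' | h' | h'
      · exact h'
      · rw [h'] at h₁; omega
      · rw [h'] at h₁; omega)
    (fun q h hlen hI => by
      by_cases hP : prof h.length y < prof h.length z
      · refine Or.inr ⟨⟨{x, y}, ?_⟩, fun o o' ho ho' _ => ?_⟩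
        · simp only [countFrom, hP, votes_append_singleton, List.length_append, hzy, hzx,
            Finset.mem_insert, Finset.mem_singleton, List.length_singleton, if_true, if_false,
            not_true, true_or, or_true, or_false] at hI ⊢
          omega
        · subst ho
          have := hdom h.length (by omega)
          rcases hcases o' with rfl | rfl | rfl <;> omega
      · refine Or.inr ⟨⟨{x}, ?_⟩, fun o o' ho ho' heq => ?_⟩
        · simp only [countFrom, hP, votes_append_singleton, List.length_append, hzx, hxy.symm,
            Finset.mem_singleton, List.length_singleton, if_true, if_false,
            not_false_iff] at hI ⊢
          omega
        · subst ho
          have := hdom h.length (by omega)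
          have := hz_loses _ h hlen hI.1
          rcases hcases o' with rfl | rfl | rfl
          · exact absurd rfl ho'
          · omega
          · exact absurd heq.symm this)
  refine hxy ((hx_wins n [] (by simp) ?_).symm.trans hy)
  simp only [votes, List.countP_nil, List.length_nil, zero_add]
  omega

end ThreeAlternatives

/-- With three alternatives and at least two voters, the Pareto-dominated weak
paradox cannot happen under approval voting with deterministic tie-breaking,
approval voting with uniform tie-breaking, or plurality voting with uniform
tie-breaking: if every voter strictly prefers `x` to `y`, then `y` is not
(part of) the SPE outcome in any of these three voting systems. -/
theorem no_pareto_dominated_three_alternatives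
    (n : ℕ) (hn : 2 ≤ n) (prof : ℕ → Fin 3 → ℕ)
    (hinj : ∀ i < n, Function.Injective (prof i))
    (x y : Fin 3) (hdom : ∀ i < n, prof i x < prof i y) :
    (∀ tb : Fin 3 → ℕ, Function.Injective tb →
      speOut (fun i (u v : Fin 3) => prof i v < prof i u)
        (fun h : List (Finset (Fin 3)) => detWinner tb h) n [] ≠ y) ∧
    y ∉ speOut (fun i (S S' : Finset (Fin 3)) => liftBetter (prof i) 3 S' S)
        (fun h : List (Finset (Fin 3)) => winSet h) n [] ∧
    y ∉ speOut (fun i (S S' : Finset (Fin 3)) => liftBetter (prof i) 3 S' S)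
        (fun h : List (Option (Fin 3)) => winSet (h.map Option.toFinset)) n [] := by
  refine ⟨fun tb htb => speOut_det_ne htb hn hinj hdom, ?_, ?_⟩
  · simpa only [List.map_id] using
      notMem_speOut_uniform (val := (id : Finset (Fin 3) → Finset (Fin 3))) (by omega) hinj hdom
        fun w => ⟨{w}, rfl⟩
  · exact notMem_speOut_uniform (by omega) hinj hdom fun w => ⟨some w, rfl⟩
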